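/- Let P and Q be non-reverse polylines satisfying the hypotheses of the sorted sum (first shifts of the same direction and rot P = rot Q). If aco P > −π and aco Q > −π, then aco(P +ₛ Q) ≥ min{aco P, aco Q}. -/

import Mathlib

open Real Set Pointwise

noncomputable section

/-- The signed angle from `v` to `w`, in `(-π, π]`; for nonzero non-opposite
vectors it lies in `(-π, π)` and its sign is the sign of the skew product. -/
def vangle (v w : ℝ × ℝ) : ℝ :=
  Complex.arg ((w.1 + w.2 * Complex.I) / (v.1 + v.2 * Complex.I))

/-- `w` is opposite to `v` : `w = a • v` with `a < 0`. -/
def Opp (v w : ℝ × ℝ) : Prop := ∃ a : ℝ, a < 0 ∧ w = a • v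

/-- A shift sequence is non-reverse if no two consecutive shifts are opposite. -/
def NonReverse (s : List (ℝ × ℝ)) : Prop := List.Chain' (fun v w => ¬ Opp v w) s

/-- The rotation of a polyline with the given shift sequence:
the sum of the signed angles between consecutive shifts. -/
def rotShifts : List (ℝ × ℝ) → ℝ
  | v :: w :: rest => vangle v w + rotShifts (w :: rest)
  | _ => 0

/-- The angular convexity of a polyline with shift sequence `s` :
the minimum of the rotations of its contiguous subpolylines. -/
def acoShifts (s : List (ℝ × ℝ)) : ℝ :=
  sInf (rotShifts '' { t : List (ℝ × ℝ) | t <:+: s })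

/-- The (cyclic) rotation of a closed polyline with shift sequence `s`. -/
def rotClosed (s : List (ℝ × ℝ)) : ℝ := rotShifts (s ++ s.take 1)

/-- The angular convexity of a closed polyline with shift sequence `s` :
the minimum of the rotations over all (possibly wrapping) contiguous
subpolylines traversing the cycle at most once, oriented along it. -/
def acoClosed (s : List (ℝ × ℝ)) : ℝ :=
  sInf (rotShifts '' { t : List (ℝ × ℝ) | t.length ≤ s.length ∧ t <:+: (s ++ s) })

/-- A polyline, given by its first vertex and its shift sequence. -/
structure Polyline where
  start : ℝ × ℝ
  shifts : List (ℝ × ℝ)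

namespace Polyline

/-- A genuine polyline: at least one edge and consecutive vertices distinct. -/
def Proper (P : Polyline) : Prop := P.shifts ≠ [] ∧ ∀ v ∈ P.shifts, v ≠ 0

/-- The `i`-th vertex (`0`-indexed). -/
def vert (P : Polyline) (i : ℕ) : ℝ × ℝ := P.start + (P.shifts.take i).sum

/-- The natural piecewise-linear parameterization of `P` on `[0, number of edges]`. -/
def param (P : Polyline) (t : ℝ) : ℝ × ℝ :=
  P.vert ⌊t⌋.toNat + Int.fract t • P.shifts.getD ⌊t⌋.toNat 0

/-- The polyline as a subset of the plane. -/
def trace (P : Polyline) : Set (ℝ × ℝ) := P.param '' Set.Icc 0 (P.shifts.length : ℝ)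

/-- A closed polyline: the last vertex equals the first one. -/
def Closed (P : Polyline) : Prop := P.shifts.sum = 0

/-- A simple (open) polyline: edges may intersect only at a common vertex of
consecutive edges, i.e. the natural parameterization is injective. -/
def Simple (P : Polyline) : Prop := Set.InjOn P.param (Set.Icc 0 (P.shifts.length : ℝ))

/-- A simple closed polyline: closed and injective except for first = last point. -/
def SimpleClosed (P : Polyline) : Prop :=
  P.Closed ∧ Set.InjOn P.param (Set.Ico 0 (P.shifts.length : ℝ))

/-- The `i`-th edge as a segment in the plane. -/
def edge (P : Polyline) (i : ℕ) : Set (ℝ × ℝ) := segment ℝ (P.vert i) (P.vert (i + 1))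

/-- A polyline is in general position if all vertices are distinct, two edges meet
in at most one point which is either the common vertex of consecutive edges or lies
in the relative interiors of both, and no three edges have a common point. -/
def GeneralPosition (P : Polyline) : Prop :=
  (∀ i j, i < j → j ≤ P.shifts.length → P.vert i ≠ P.vert j) ∧
  (∀ i j, i < j → j < P.shifts.length →
    (P.edge i ∩ P.edge j).Subsingleton ∧
    ∀ x ∈ P.edge i ∩ P.edge j,
      (j = i + 1 ∧ x = P.vert j) ∨
      (x ∈ openSegment ℝ (P.vert i) (P.vert (i + 1)) ∧
        x ∈ openSegment ℝ (P.vert j) (P.vert (j + 1)))) ∧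
  ∀ i j k, i < j → j < k → k < P.shifts.length →
    P.edge i ∩ P.edge j ∩ P.edge k = ∅

end Polyline

/-- `P` is the (anticlockwise-oriented) closed simple boundary polyline of the
simple polygon `K`. -/
structure IsSimplePolygon (K : Set (ℝ × ℝ)) (P : Polyline) : Prop where
  compact : IsCompact K
  regular : K = closure (interior K)
  proper : P.Proper
  nonReverse : NonReverse (P.shifts ++ P.shifts.take 1)
  simpleClosed : P.SimpleClosed
  boundary : frontier K = P.trace
  orient : rotClosed P.shifts = 2 * π

/-- The ray with apex `x` and direction `d`. -/
def ray (x d : ℝ × ℝ) : Set (ℝ × ℝ) := {y | ∃ t : ℝ, 0 ≤ t ∧ y = x + t • d}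

/-- The angular region with apex `x` spanned by the directions `u` and `v` :
the convex hull of the two rays. Its angular measure is `|vangle u v|`. -/
def angularRegion (x u v : ℝ × ℝ) : Set (ℝ × ℝ) :=
  convexHull ℝ (ray x u ∪ ray x v)

/-- The merge of two shift sequences used in the sorted sum: repeatedly take the
head of the remaining sequence with the larger rotation (preferring the first). -/
def sortedMerge : List (ℝ × ℝ) → List (ℝ × ℝ) → List (ℝ × ℝ)
  | [], t => t
  | s, [] => s
  | a :: s, b :: t =>
    if rotShifts (b :: t) ≤ rotShifts (a :: s) then a :: sortedMerge s (b :: t)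
    else b :: sortedMerge (a :: s) t
termination_by s t => s.length + t.length

/-- The hypotheses of the sorted sum: both polylines are proper and non-reverse,
their first shifts have the same direction, and their rotations are equal. -/
def SortedSumHyp (P Q : Polyline) : Prop :=
  P.Proper ∧ Q.Proper ∧ NonReverse P.shifts ∧ NonReverse Q.shifts ∧
  vangle P.shifts.headI Q.shifts.headI = 0 ∧
  rotShifts P.shifts = rotShifts Q.shifts

/-- The sorted sum `P +ₛ Q` : starts at the sum of the first vertices and has the
merged shift sequence. -/
def sortedSum (P Q : Polyline) : Polyline :=
  ⟨P.start + Q.start, sortedMerge P.shifts Q.shifts⟩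

/-- Direction of a vector as an angle modulo `2π`. -/
def sdir (v : ℝ × ℝ) : Real.Angle := (Complex.arg (v.1 + v.2 * Complex.I) : ℝ)

lemma cplx_ne_zero {v : ℝ × ℝ} (hv : v ≠ 0) : ((v.1 : ℂ) + v.2 * Complex.I) ≠ 0 := by
  intro h
  apply hv
  have h1 := congrArg Complex.re h
  have h2 := congrArg Complex.im h
  simp at h1 h2
  exact Prod.ext h1 h2

lemma vangle_coe {v w : ℝ × ℝ} (hv : v ≠ 0) (hw : w ≠ 0) :
    ((vangle v w : ℝ) : Real.Angle) = sdir w - sdir v := by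
  unfold vangle sdir
  exact Complex.arg_div_coe_angle (cplx_ne_zero hw) (cplx_ne_zero hv)

lemma vangle_eq {v w : ℝ × ℝ} (hv : v ≠ 0) (hw : w ≠ 0) {r : ℝ} (h1 : -π < r) (h2 : r ≤ π)
    (h : sdir v + (r : Real.Angle) = sdir w) : vangle v w = r := by
  have h3 : ((vangle v w : ℝ) : Real.Angle) = (r : Real.Angle) := by
    rw [vangle_coe hv hw, ← h]; abel
  have h4 := congrArg Real.Angle.toReal h3
  rw [Real.Angle.toReal_coe_eq_self_iff.2 ⟨h1, h2⟩,
    Real.Angle.toReal_coe_eq_self_iff.2 (show -π < vangle v w ∧ vangle v w ≤ π from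
      ⟨Complex.neg_pi_lt_arg _, Complex.arg_le_pi _⟩)] at h4
  exact h4

lemma vangle_le (v w : ℝ × ℝ) : vangle v w ≤ π := Complex.arg_le_pi _

lemma rot_split (L : List (ℝ × ℝ)) (z : ℝ × ℝ) (R : List (ℝ × ℝ)) :
    rotShifts (L ++ z :: R) = rotShifts (L ++ [z]) + rotShifts (z :: R) := by
  induction L with
  | nil => simp [rotShifts]
  | cons a L ih =>
    cases L with
    | nil => simp [rotShifts]
    | cons b L =>
      simp only [List.cons_append, rotShifts] at ih ⊢
      rw [ih]; ring

lemma merge_nil_left (t : List (ℝ × ℝ)) : sortedMerge [] t = t := by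
  rw [sortedMerge]

lemma merge_nil_right (s : List (ℝ × ℝ)) : sortedMerge s [] = s := by
  cases s <;> simp [sortedMerge]

lemma merge_le {a b : ℝ × ℝ} {s t : List (ℝ × ℝ)}
    (h : rotShifts (b :: t) ≤ rotShifts (a :: s)) :
    sortedMerge (a :: s) (b :: t) = a :: sortedMerge s (b :: t) := by
  rw [sortedMerge, if_pos h]

lemma merge_lt {a b : ℝ × ℝ} {s t : List (ℝ × ℝ)}
    (h : rotShifts (a :: s) < rotShifts (b :: t)) :
    sortedMerge (a :: s) (b :: t) = b :: sortedMerge (a :: s) t := by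
  rw [sortedMerge, if_neg (not_le.2 h)]

/-- Rotation of the merge is the larger of the rotations. -/
lemma rot_merge (n : ℕ) : ∀ (a b : ℝ × ℝ) (s t : List (ℝ × ℝ)), s.length + t.length = n →
    (∀ v ∈ a :: s, v ≠ 0) → (∀ v ∈ b :: t, v ≠ 0) →
    -π < rotShifts (a :: s) → -π < rotShifts (b :: t) →
    (∀ u, u <:+ a :: s → -π < rotShifts u) → (∀ u, u <:+ b :: t → -π < rotShifts u) →
    sdir a + (rotShifts (a :: s) : Real.Angle) = sdir b + (rotShifts (b :: t) : Real.Angle) →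
    rotShifts (sortedMerge (a :: s) (b :: t)) = max (rotShifts (a :: s)) (rotShifts (b :: t)) := by
  induction n with
  | zero =>
    intro a b s t hn ha hb _ _ _ _ hd
    obtain rfl : s = [] := List.length_eq_zero_iff.1 (by omega)
    obtain rfl : t = [] := List.length_eq_zero_iff.1 (by omega)
    rw [merge_le (by simp [rotShifts]), merge_nil_left]
    simp only [rotShifts, Real.Angle.coe_zero, add_zero, max_self] at hd ⊢
    exact vangle_eq (ha _ (by simp)) (hb _ (by simp)) (by linarith [pi_pos]) pi_pos.le
      (by simpa using hd)
  | succ n ih =>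
    intro a b s t hn ha hb hra hrb hsa hsb hd
    have ha0 : a ≠ 0 := ha _ (by simp)
    have hb0 : b ≠ 0 := hb _ (by simp)
    have hab : sdir a + ((rotShifts (a :: s) - rotShifts (b :: t) : ℝ) : Real.Angle) = sdir b := by
      rw [Real.Angle.coe_sub, ← add_sub_assoc, hd]; abel
    have hba : sdir b + ((rotShifts (b :: t) - rotShifts (a :: s) : ℝ) : Real.Angle) = sdir a := by
      rw [Real.Angle.coe_sub, ← add_sub_assoc, ← hd]; abel
    rcases le_or_gt (rotShifts (b :: t)) (rotShifts (a :: s)) with h | h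
    · rw [merge_le h, max_eq_left h]
      cases s with
      | nil =>
        rw [merge_nil_left]
        have h0 : rotShifts [a] = 0 := by simp [rotShifts]
        rw [h0] at hab h ⊢
        rw [rotShifts, vangle_eq ha0 hb0 (by linarith [pi_pos]) (by linarith) hab]
        ring
      | cons a' s =>
        have hna : a' ≠ 0 := ha _ (by simp)
        have hd' : sdir a' + (rotShifts (a' :: s) : Real.Angle)
            = sdir b + (rotShifts (b :: t) : Real.Angle) := by
          rw [← hd, rotShifts, Real.Angle.coe_add, vangle_coe ha0 hna]; abel
        have hsf : (a' :: s) <:+ a :: a' :: s := List.suffix_cons _ _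
        have IH := ih a' b s t (by simp at hn; omega) (fun v hv => ha v (List.mem_cons_of_mem _ hv)) hb
          (hsa _ hsf) hrb (fun u hu => hsa u (hu.trans hsf)) hsb hd'
        have hrec : rotShifts (a :: a' :: s) = vangle a a' + rotShifts (a' :: s) := by
          rw [rotShifts]
        rcases le_or_gt (rotShifts (b :: t)) (rotShifts (a' :: s)) with h' | h'
        · rw [merge_le h', max_eq_left h'] at IH
          rw [merge_le h', rotShifts, IH, hrec]
        · rw [merge_lt h', max_eq_right h'.le] at IH
          rw [merge_lt h', rotShifts, IH, vangle_eq ha0 hb0 _ _ hab]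
          · ring
          · linarith [pi_pos]
          · linarith [vangle_le a a']
    · rw [merge_lt h, max_eq_right h.le]
      cases t with
      | nil =>
        rw [merge_nil_right]
        have h0 : rotShifts [b] = 0 := by simp [rotShifts]
        rw [h0] at hba h ⊢
        rw [rotShifts, vangle_eq hb0 ha0 (by linarith [pi_pos]) (by linarith) hba]
        ring
      | cons b' t =>
        have hnb : b' ≠ 0 := hb _ (by simp)
        have hd' : sdir a + (rotShifts (a :: s) : Real.Angle)
            = sdir b' + (rotShifts (b' :: t) : Real.Angle) := by
          rw [hd, rotShifts, Real.Angle.coe_add, vangle_coe hb0 hnb]; abel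
        have hsf : (b' :: t) <:+ b :: b' :: t := List.suffix_cons _ _
        have IH := ih a b' s t (by simp at hn; omega) ha (fun v hv => hb v (List.mem_cons_of_mem _ hv))
          hra (hsb _ hsf) hsa (fun u hu => hsb u (hu.trans hsf)) hd'
        have hrec : rotShifts (b :: b' :: t) = vangle b b' + rotShifts (b' :: t) := by
          rw [rotShifts]
        rcases le_or_gt (rotShifts (b' :: t)) (rotShifts (a :: s)) with h' | h'
        · rw [merge_le h', max_eq_left h'] at IH
          rw [merge_le h', rotShifts, IH, vangle_eq hb0 ha0 _ _ hba]
          · ring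
          · linarith [pi_pos]
          · linarith [vangle_le b b']
        · rw [merge_lt h', max_eq_right h'.le] at IH
          rw [merge_lt h', rotShifts, IH, hrec]

/-- Every suffix of a merge is a merge of suffixes. -/
lemma merge_suffix (n : ℕ) : ∀ (S T R : List (ℝ × ℝ)), S.length + T.length = n →
    R <:+ sortedMerge S T → ∃ S' T', S' <:+ S ∧ T' <:+ T ∧ R = sortedMerge S' T' := by
  induction n with
  | zero =>
    intro S T R hn hR
    obtain rfl : S = [] := List.length_eq_zero_iff.1 (by omega)
    obtain rfl : T = [] := List.length_eq_zero_iff.1 (by omega)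
    rw [merge_nil_left] at hR
    exact ⟨[], [], List.suffix_rfl, List.suffix_rfl, by
      rw [merge_nil_left]; exact List.suffix_nil.1 hR⟩
  | succ n ih =>
    intro S T R hn hR
    rcases S with _ | ⟨a, s⟩
    · rw [merge_nil_left] at hR
      exact ⟨[], R, List.suffix_rfl, hR, (merge_nil_left R).symm⟩
    rcases T with _ | ⟨b, t⟩
    · rw [merge_nil_right] at hR
      exact ⟨R, [], hR, List.suffix_rfl, (merge_nil_right R).symm⟩
    rcases le_or_gt (rotShifts (b :: t)) (rotShifts (a :: s)) with h | h
    · rw [merge_le h, List.suffix_cons_iff] at hR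
      rcases hR with hR | hR
      · exact ⟨a :: s, b :: t, List.suffix_rfl, List.suffix_rfl, by rw [merge_le h, hR]⟩
      · obtain ⟨S', T', h1, h2, h3⟩ := ih s (b :: t) R (by simp at hn ⊢; omega) hR
        exact ⟨S', T', h1.trans (List.suffix_cons _ _), h2, h3⟩
    · rw [merge_lt h, List.suffix_cons_iff] at hR
      rcases hR with hR | hR
      · exact ⟨a :: s, b :: t, List.suffix_rfl, List.suffix_rfl, by rw [merge_lt h, hR]⟩
      · obtain ⟨S', T', h1, h2, h3⟩ := ih (a :: s) t R (by simp at hn ⊢; omega) hR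
        exact ⟨S', T', h1, h2.trans (List.suffix_cons _ _), h3⟩

/-- Final direction is the same for nonempty suffixes. -/
lemma final_dir {a z : ℝ × ℝ} {s r : List (ℝ × ℝ)} (h : z :: r <:+ a :: s)
    (h0 : ∀ v ∈ a :: s, v ≠ 0) :
    sdir z + (rotShifts (z :: r) : Real.Angle) = sdir a + (rotShifts (a :: s) : Real.Angle) := by
  induction s generalizing a with
  | nil =>
    have := List.suffix_cons_iff.1 h
    simp at this
    rw [this.1, this.2]
  | cons a' s ih =>
    rcases List.suffix_cons_iff.1 h with h | h
    · simp only [List.cons.injEq] at h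
      rw [h.1, h.2]
    · rw [ih h (fun v hv => h0 v (List.mem_cons_of_mem _ hv)), rotShifts.eq_1 a a' s,
        Real.Angle.coe_add, vangle_coe (h0 _ (by simp)) (h0 _ (by simp))]
      abel

lemma aco_bdd (s : List (ℝ × ℝ)) : BddBelow (rotShifts '' { t : List (ℝ × ℝ) | t <:+: s }) := by
  apply Set.Finite.bddBelow
  apply Set.Finite.image
  apply Set.Finite.subset (List.finite_toSet s.sublists)
  intro t ht
  simpa using ht.sublist

lemma aco_le {s t : List (ℝ × ℝ)} (h : t <:+: s) : acoShifts s ≤ rotShifts t :=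
  csInf_le (aco_bdd s) ⟨t, h, rfl⟩

lemma aco_le_sub {S T : List (ℝ × ℝ)} {z : ℝ × ℝ} {r : List (ℝ × ℝ)} (hS : S <:+: T)
    (h : z :: r <:+ S) : acoShifts T ≤ rotShifts S - rotShifts (z :: r) := by
  obtain ⟨A, rfl⟩ := h
  rw [rot_split, add_sub_cancel_right]
  refine aco_le (List.IsInfix.trans ⟨[], r, ?_⟩ hS)
  simp

/-- **Lemma (angular convexity of the sorted sum).** If `P, Q` satisfy the
sorted-sum hypotheses and `aco P, aco Q > -π`, then
`aco (P +ₛ Q) ≥ min (aco P) (aco Q)`. -/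
theorem sortedSum_aco (P Q : Polyline) (h : SortedSumHyp P Q)
    (hP : -π < acoShifts P.shifts) (hQ : -π < acoShifts Q.shifts) :
    min (acoShifts P.shifts) (acoShifts Q.shifts) ≤
      acoShifts (sortedSum P Q).shifts := by
  obtain ⟨⟨hPn, hP0⟩, ⟨hQn, hQ0⟩, -, -, hang, hrot⟩ := h
  obtain ⟨p0, S⟩ := P
  obtain ⟨q0, T⟩ := Q
  simp only [sortedSum] at *
  obtain ⟨a, s, rfl⟩ := List.exists_cons_of_ne_nil hPn
  obtain ⟨b, t, rfl⟩ := List.exists_cons_of_ne_nil hQn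
  simp only [List.headI] at hang
  have hdir : sdir a = sdir b := by
    have := vangle_coe (hP0 a (by simp)) (hQ0 b (by simp))
    rw [hang, Real.Angle.coe_zero] at this
    exact (sub_eq_zero.1 this.symm).symm
  have hE : sdir a + (rotShifts (a :: s) : Real.Angle)
      = sdir b + (rotShifts (b :: t) : Real.Angle) := by rw [hdir, hrot]
  -- rotation of merges of suffixes
  have key : ∀ x S' y T', x :: S' <:+ a :: s → y :: T' <:+ b :: t →
      rotShifts (sortedMerge (x :: S') (y :: T'))
        = max (rotShifts (x :: S')) (rotShifts (y :: T')) := by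
    intro x S' y T' hx hy
    have hx' : ∀ u, u <:+ x :: S' → -π < rotShifts u := fun u hu =>
      hP.trans_le (aco_le (hu.trans hx).isInfix)
    have hy' : ∀ u, u <:+ y :: T' → -π < rotShifts u := fun u hu =>
      hQ.trans_le (aco_le (hu.trans hy).isInfix)
    exact rot_merge _ x y S' T' rfl (fun v hv => hP0 v (hx.subset hv))
      (fun v hv => hQ0 v (hy.subset hv)) (hx' _ List.suffix_rfl) (hy' _ List.suffix_rfl) hx' hy'
      (by rw [final_dir hx hP0, final_dir hy hQ0, hE])
  have up : ∀ S' T', S' <:+ a :: s → T' <:+ b :: t →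
      (S' ≠ [] → rotShifts S' ≤ rotShifts (sortedMerge S' T')) ∧
      (T' ≠ [] → rotShifts T' ≤ rotShifts (sortedMerge S' T')) := by
    intro S' T' hS hT
    rcases S' with _ | ⟨x, S'⟩
    · simp [merge_nil_left]
    rcases T' with _ | ⟨y, T'⟩
    · simp [merge_nil_right]
    rw [key _ _ _ _ hS hT]
    simp
  have attain : ∀ S' T', S' <:+ a :: s → T' <:+ b :: t → sortedMerge S' T' ≠ [] →
      (S' ≠ [] ∧ rotShifts (sortedMerge S' T') = rotShifts S') ∨
      (T' ≠ [] ∧ rotShifts (sortedMerge S' T') = rotShifts T') := by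
    intro S' T' hS hT hne
    rcases S' with _ | ⟨x, S'⟩
    · rw [merge_nil_left] at hne ⊢; exact Or.inr ⟨hne, rfl⟩
    rcases T' with _ | ⟨y, T'⟩
    · rw [merge_nil_right] at hne ⊢; exact Or.inl ⟨hne, rfl⟩
    rw [key _ _ _ _ hS hT]
    rcases max_choice (rotShifts (x :: S')) (rotShifts (y :: T')) with h | h
    · exact Or.inl ⟨by simp, h⟩
    · exact Or.inr ⟨by simp, h⟩
  refine le_csInf ⟨_, [], List.nil_infix, rfl⟩ ?_
  rintro _ ⟨L, hL, rfl⟩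
  rcases List.eq_nil_or_concat L with rfl | ⟨L, z, rfl⟩
  · exact (min_le_left _ _).trans (aco_le List.nil_infix)
  obtain ⟨A, B, hAB⟩ := hL
  have h1 : (L ++ z :: B) <:+ sortedMerge (a :: s) (b :: t) := ⟨A, by rw [← hAB]; simp⟩
  obtain ⟨S₁, T₁, hS₁, hT₁, hM₁⟩ := merge_suffix _ _ _ _ rfl h1
  have h2 : z :: B <:+ sortedMerge S₁ T₁ := ⟨L, hM₁⟩
  obtain ⟨S₂, T₂, hS₂, hT₂, hM₂⟩ := merge_suffix _ _ _ _ rfl h2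
  have hsplit := rot_split L z B
  have hup := up S₁ T₁ hS₁ hT₁
  rw [hM₁] at hsplit
  simp only [List.concat_eq_append] at *
  rcases attain S₂ T₂ (hS₂.trans hS₁) (hT₂.trans hT₁) (by rw [← hM₂]; simp) with ⟨hne, he⟩ | ⟨hne, he⟩
  · obtain ⟨x, r, rfl⟩ := List.exists_cons_of_ne_nil hne
    have h3 := aco_le_sub hS₁.isInfix hS₂
    have h4 := hup.1 (by rintro rfl; simp at hS₂)
    rw [← hM₂] at he
    refine (min_le_left _ _).trans ?_
    linarith
  · obtain ⟨x, r, rfl⟩ := List.exists_cons_of_ne_nil hne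
    have h3 := aco_le_sub hT₁.isInfix hT₂
    have h4 := hup.2 (by rintro rfl; simp at hT₂)
    rw [← hM₂] at he
    refine (min_le_right _ _).trans ?_
    linarith
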